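/- Let k ≥ 1, let f = (f₁,…,f_m) : ℝⁿ → ℝᵐ and g : ℝᵐ → ℂ be C^k, let x₀ ∈ ℝⁿ, and let γ ∈ ℕ₀ⁿ be a multi-index with 1 ≤ |γ| ≤ k. Then the higher-order chain rule holds: ∂^γ(g∘f)(x₀) = Σ_{α∈ℕ₀ᵐ, 1≤|α|≤|γ|} ∂^α g(f(x₀)) · Σ_N γ! · Π_{j=1}^m Π_{β∈ℕ₀ⁿ, 1≤|β|≤|γ|} (1/N(j,β)!) · (∂^β f_j(x₀)/β!)^{N(j,β)}, where the inner sum runs over all families N of nonnegative integers N(j,β), indexed by j ∈ {1,…,m} and multi-indices β ∈ ℕ₀ⁿ with 1 ≤ |β| ≤ |γ|, subject to the constraints Σ_β N(j,β) = α_j for each j ∈ {1,…,m} and Σ_{j=1}^m Σ_β N(j,β)·β = γ. -/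

import Mathlib

/-- The partial derivative `∂_i f` of a function on `ℝⁿ`. -/
noncomputable def pd {n : ℕ} {E : Type*} [NormedAddCommGroup E] [NormedSpace ℝ E]
    (i : Fin n) (f : (Fin n → ℝ) → E) : (Fin n → ℝ) → E :=
  fun x => fderiv ℝ f x (Pi.single i 1)

/-- The multi-index partial derivative `∂^α f = ∂₁^{α₁} ⋯ ∂ₙ^{αₙ} f`. -/
noncomputable def mderiv {n : ℕ} {E : Type*} [NormedAddCommGroup E] [NormedSpace ℝ E]
    (α : Fin n → ℕ) (f : (Fin n → ℝ) → E) : (Fin n → ℝ) → E :=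
  (List.finRange n).foldr (fun i g => (pd i)^[α i] g) f

/-- The finite set of multi-indices `β ∈ ℕ₀ⁿ` with `1 ≤ |β| ≤ K` (every such `β` has all
components `≤ K`, so this set is exhaustive). -/
def multiIdxBetween (n K : ℕ) : Finset (Fin n → ℕ) :=
  (Fintype.piFinset fun _ : Fin n => Finset.range (K + 1)).filter fun β =>
    1 ≤ ∑ i, β i ∧ ∑ i, β i ≤ K

/-- The index type of the families `N = (N(j,β))` appearing in the multivariate
Faà di Bruno formula: pairs of `j ∈ {1,…,m}` and multi-indices `β` with `1 ≤ |β| ≤ K`. -/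
abbrev famIdx (n m K : ℕ) := Fin m × {β : Fin n → ℕ // β ∈ multiIdxBetween n K}

/-- The finite set of families `N` of nonnegative integers `N(j,β)` subject to
`Σ_β N(j,β) = α_j` for each `j` and `Σ_{j,β} N(j,β)·β = γ` (such `N(j,β)` are
automatically `≤ K` when `|α| ≤ K`). -/
def famSet (n m K : ℕ) (α : Fin m → ℕ) (γ : Fin n → ℕ) : Finset (famIdx n m K → ℕ) :=
  (Fintype.piFinset fun _ : famIdx n m K => Finset.range (K + 1)).filter fun N =>
    (∀ j : Fin m, ∑ b : {β : Fin n → ℕ // β ∈ multiIdxBetween n K}, N (j, b) = α j) ∧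
    (∀ i : Fin n,
      ∑ j : Fin m, ∑ b : {β : Fin n → ℕ // β ∈ multiIdxBetween n K},
        N (j, b) * (b : Fin n → ℕ) i = γ i)


open MvPolynomial in
/-- `IsJet x K h p` says that the polynomial `p` agrees with the Taylor expansion of `h` at `x` up
to total degree `K`: the values agree, and the first partial derivatives agree to order `K - 1`. -/
def IsJet {n : ℕ} {𝕜 : Type*} [RCLike 𝕜] (x : Fin n → ℝ) :
    ℕ → ((Fin n → ℝ) → 𝕜) → MvPolynomial (Fin n) 𝕜 → Prop
  | 0, h, p => constantCoeff p = h x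
  | K + 1, h, p => constantCoeff p = h x ∧ ∀ i, IsJet x K (pd i h) (pderiv i p)

section PartialDerivatives

variable {n : ℕ} {E : Type*} [NormedAddCommGroup E] [NormedSpace ℝ E]

lemma ContDiff.partialDeriv {K : ℕ} {h : (Fin n → ℝ) → E} (hh : ContDiff ℝ (K + 1 : ℕ) h)
    (i : Fin n) : ContDiff ℝ K (pd i h) :=
  (hh.fderiv_right (m := K) (by norm_cast)).clm_apply contDiff_const

lemma ContDiff.partialDeriv_iterate {K : ℕ} (i : Fin n) (a : ℕ) {h : (Fin n → ℝ) → E}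
    (hh : ContDiff ℝ (K + a : ℕ) h) : ContDiff ℝ K ((pd i)^[a] h) := by
  induction a generalizing h with
  | zero => simpa using hh
  | succ a ih => exact ih (ContDiff.partialDeriv (by rwa [add_assoc]) i)

lemma pd_comm {h : (Fin n → ℝ) → E} (hh : ContDiff ℝ 2 h) (i j : Fin n) :
    pd i (pd j h) = pd j (pd i h) := by
  have hd : Differentiable ℝ (fderiv ℝ h) :=
    (hh.fderiv_right (m := 1) (by norm_num)).differentiable (by norm_num)
  have key (i j : Fin n) (x : Fin n → ℝ) :
      pd i (pd j h) x = fderiv ℝ (fderiv ℝ h) x (Pi.single i 1) (Pi.single j 1) := by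
    have := fderiv_clm_apply (hd x) (differentiableAt_const (Pi.single j (1 : ℝ)))
    change fderiv ℝ (fun y => fderiv ℝ h y (Pi.single j 1)) x _ = _
    simp [this]
  ext x
  rw [key, key]
  exact hh.contDiffAt.isSymmSndFDerivAt (by simp) _ _

lemma pd_iterate_comm (i j : Fin n) (a : ℕ) {h : (Fin n → ℝ) → E}
    (hh : ContDiff ℝ (a + 1 : ℕ) h) : pd i ((pd j)^[a] h) = (pd j)^[a] (pd i h) := by
  induction a generalizing h with
  | zero => rfl
  | succ a ih =>
    rw [Function.iterate_succ_apply, Function.iterate_succ_apply, ih (hh.partialDeriv j),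
      pd_comm (hh.of_le (by norm_cast; omega))]

lemma ContDiff.foldr_pd (β : Fin n → ℕ) (l : List (Fin n)) {K : ℕ} {h : (Fin n → ℝ) → E}
    (hh : ContDiff ℝ (K + (l.map β).sum : ℕ) h) :
    ContDiff ℝ K (l.foldr (fun i g => (pd i)^[β i] g) h) := by
  induction l generalizing K with
  | nil => simpa using hh
  | cons a l ih =>
    refine ContDiff.partialDeriv_iterate a (β a) (ih ?_)
    rwa [add_assoc, ← List.sum_cons, ← List.map_cons]

lemma pd_foldr_comm (i : Fin n) (β : Fin n → ℕ) (l : List (Fin n)) {h : (Fin n → ℝ) → E}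
    (hh : ContDiff ℝ ((l.map β).sum + 1 : ℕ) h) :
    pd i (l.foldr (fun i g => (pd i)^[β i] g) h) =
      l.foldr (fun i g => (pd i)^[β i] g) (pd i h) := by
  induction l with
  | nil => rfl
  | cons a l ih =>
    rw [List.map_cons, List.sum_cons] at hh
    rw [List.foldr_cons, List.foldr_cons, pd_iterate_comm,
      ih (hh.of_le (by norm_cast; omega))]
    exact ContDiff.foldr_pd β l (hh.of_le (by norm_cast; omega))

lemma foldr_pd_add_single (i : Fin n) (β : Fin n → ℕ) (l : List (Fin n)) (hl : l.Nodup)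
    {h : (Fin n → ℝ) → E} (hh : ContDiff ℝ ((l.map β).sum + 1 : ℕ) h) :
    l.foldr (fun j g => (pd j)^[(β + Pi.single i 1 : Fin n → ℕ) j] g) h =
      if i ∈ l then l.foldr (fun j g => (pd j)^[β j] g) (pd i h)
      else l.foldr (fun j g => (pd j)^[β j] g) h := by
  induction l with
  | nil => simp
  | cons a l ih =>
    rw [List.map_cons, List.sum_cons] at hh
    have hl' := List.nodup_cons.1 hl
    have ih := ih hl'.2 (hh.of_le (by norm_cast; omega))
    rw [List.foldr_cons, ih]
    by_cases hai : i = a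
    · subst hai
      simp only [hl'.1, if_false, List.mem_cons_self, if_true, List.foldr_cons, Pi.add_apply,
        Pi.single_eq_same, Function.iterate_succ_apply]
      rw [pd_foldr_comm i β l (hh.of_le (by norm_cast; omega))]
    · have : (β + Pi.single i 1 : Fin n → ℕ) a = β a := by
        simp [Pi.single_eq_of_ne (Ne.symm hai)]
      simp only [this, List.mem_cons, hai, false_or, List.foldr_cons]
      split_ifs <;> rfl

lemma mderiv_add_single (i : Fin n) (β : Fin n → ℕ) {h : (Fin n → ℝ) → E}
    (hh : ContDiff ℝ (∑ j, β j + 1 : ℕ) h) :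
    mderiv (β + Pi.single i 1) h = mderiv β (pd i h) := by
  have := foldr_pd_add_single i β (List.finRange n) (List.nodup_finRange n) (h := h)
    (by rwa [← List.ofFn_eq_map, List.sum_ofFn])
  simpa [mderiv] using this

lemma mderiv_zero (h : (Fin n → ℝ) → E) : mderiv 0 h = h := by
  have (l : List (Fin n)) : l.foldr (fun i g => (pd i)^[(0 : Fin n → ℕ) i] g) h = h := by
    induction l with
    | nil => rfl
    | cons a l ih => rw [List.foldr_cons, ih]; rfl
  exact this _

end PartialDerivatives

section Jets

open MvPolynomial

variable {n m : ℕ} {𝕜 : Type*} [RCLike 𝕜] {x : Fin n → ℝ}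

lemma IsJet.constantCoeff_eq {K : ℕ} {h : (Fin n → ℝ) → 𝕜} {p : MvPolynomial (Fin n) 𝕜}
    (H : IsJet x K h p) : constantCoeff p = h x := by
  cases K with
  | zero => exact H
  | succ K => exact H.1

lemma IsJet.of_succ {K : ℕ} {h : (Fin n → ℝ) → 𝕜} {p : MvPolynomial (Fin n) 𝕜}
    (H : IsJet x (K + 1) h p) : IsJet x K h p := by
  induction K generalizing h p with
  | zero => exact H.1
  | succ K ih => exact ⟨H.1, fun i => ih (H.2 i)⟩

lemma isJet_zero (K : ℕ) : IsJet x K (fun _ => (0 : 𝕜)) 0 := by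
  induction K with
  | zero => simp [IsJet]
  | succ K ih =>
    refine ⟨by simp, fun i => ?_⟩
    have : pd i (fun _ : Fin n → ℝ => (0 : 𝕜)) = fun _ => 0 := by ext; simp [pd]
    rwa [this, map_zero]

lemma IsJet.add {K : ℕ} {h₁ h₂ : (Fin n → ℝ) → 𝕜} {p₁ p₂ : MvPolynomial (Fin n) 𝕜}
    (c₁ : ContDiff ℝ K h₁) (c₂ : ContDiff ℝ K h₂) (H₁ : IsJet x K h₁ p₁) (H₂ : IsJet x K h₂ p₂) :
    IsJet x K (fun y => h₁ y + h₂ y) (p₁ + p₂) := by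
  induction K generalizing h₁ h₂ p₁ p₂ with
  | zero => simp_all [IsJet]
  | succ K ih =>
    refine ⟨by simp [H₁.constantCoeff_eq, H₂.constantCoeff_eq], fun i => ?_⟩
    have : pd i (fun y => h₁ y + h₂ y) = fun y => pd i h₁ y + pd i h₂ y := by
      ext y
      simp only [pd]
      rw [fderiv_fun_add (c₁.differentiable (by norm_cast) y)
        (c₂.differentiable (by norm_cast) y)]
      rfl
    rw [this, map_add]
    exact ih (c₁.partialDeriv i) (c₂.partialDeriv i) (H₁.2 i) (H₂.2 i)

lemma IsJet.sum {ι : Type*} (s : Finset ι) {K : ℕ} {h : ι → (Fin n → ℝ) → 𝕜}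
    {p : ι → MvPolynomial (Fin n) 𝕜} (c : ∀ j, ContDiff ℝ K (h j))
    (H : ∀ j, IsJet x K (h j) (p j)) :
    IsJet x K (fun y => ∑ j ∈ s, h j y) (∑ j ∈ s, p j) := by
  classical
  induction s using Finset.induction_on with
  | empty => simpa using isJet_zero K
  | insert a s ha ih =>
    simp only [Finset.sum_insert ha]
    exact (H a).add (c a) (ContDiff.sum fun j _ => c j) ih

lemma IsJet.mul {K : ℕ} {h₁ h₂ : (Fin n → ℝ) → 𝕜} {p₁ p₂ : MvPolynomial (Fin n) 𝕜}
    (c₁ : ContDiff ℝ K h₁) (c₂ : ContDiff ℝ K h₂) (H₁ : IsJet x K h₁ p₁) (H₂ : IsJet x K h₂ p₂) :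
    IsJet x K (fun y => h₁ y * h₂ y) (p₁ * p₂) := by
  induction K generalizing h₁ h₂ p₁ p₂ with
  | zero => simp_all [IsJet]
  | succ K ih =>
    refine ⟨by simp [H₁.constantCoeff_eq, H₂.constantCoeff_eq], fun i => ?_⟩
    have : pd i (fun y => h₁ y * h₂ y) = fun y => pd i h₁ y * h₂ y + h₁ y * pd i h₂ y := by
      ext y
      simp only [pd]
      rw [fderiv_fun_mul (c₁.differentiable (by norm_cast) y)
        (c₂.differentiable (by norm_cast) y)]
      simp
      ring
    rw [this, pderiv_mul]
    have d₁ : ContDiff ℝ K h₁ := c₁.of_le (by norm_cast; omega)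
    have d₂ : ContDiff ℝ K h₂ := c₂.of_le (by norm_cast; omega)
    exact (ih (c₁.partialDeriv i) d₂ (H₁.2 i) H₂.of_succ).add ((c₁.partialDeriv i).mul d₂)
      (d₁.mul (c₂.partialDeriv i))
      (ih d₁ (c₂.partialDeriv i) H₁.of_succ (H₂.2 i))

lemma pd_ofReal {h : (Fin n → ℝ) → ℝ} (hh : Differentiable ℝ h) (i : Fin n) :
    pd i (fun y => (h y : ℂ)) = fun y => ((pd i h y : ℝ) : ℂ) := by
  ext y
  have := (Complex.ofRealCLM.hasFDerivAt.comp y (hh y).hasFDerivAt).fderiv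
  exact congrArg (fun L => L (Pi.single i 1)) this

lemma IsJet.ofReal {K : ℕ} {h : (Fin n → ℝ) → ℝ} {p : MvPolynomial (Fin n) ℝ}
    (c : ContDiff ℝ K h) (H : IsJet x K h p) :
    IsJet x K (fun y => (h y : ℂ)) (map Complex.ofRealHom p) := by
  induction K generalizing h p with
  | zero => simp_all [IsJet, constantCoeff_map]
  | succ K ih =>
    refine ⟨by simp [constantCoeff_map, H.constantCoeff_eq], fun i => ?_⟩
    rw [pd_ofReal (c.differentiable (by norm_cast)), pderiv_map]
    exact ih (c.partialDeriv i) (H.2 i)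

lemma pderiv_aeval_eq_sum {σ τ R : Type*} [Fintype σ] [CommRing R] (i : τ)
    (Y : σ → MvPolynomial τ R) (q : MvPolynomial σ R) :
    pderiv i (aeval Y q) = ∑ j, aeval Y (pderiv j q) * pderiv i (Y j) := by
  classical
  induction q using MvPolynomial.induction_on with
  | C a => simp [algebraMap_eq]
  | add p q hp hq => simp only [map_add, hp, hq, add_mul, Finset.sum_add_distrib]
  | mul_X p j hp =>
    rw [map_mul, aeval_X, pderiv_mul, hp]
    simp only [pderiv_mul, map_add, map_mul, aeval_X, add_mul, Finset.sum_add_distrib, pderiv_X]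
    rw [Finset.sum_mul]
    congr 1
    · exact Finset.sum_congr rfl fun _ _ => by ring
    · rw [Finset.sum_eq_single j] <;> simp +contextual [eq_comm]

lemma pd_comp {f : (Fin n → ℝ) → (Fin m → ℝ)} {g : (Fin m → ℝ) → ℂ} (hf : Differentiable ℝ f)
    (hg : Differentiable ℝ g) (i : Fin n) :
    pd i (fun y => g (f y)) = fun y => ∑ j, pd j g (f y) * pd i (fun z => (f z j : ℂ)) y := by
  ext y
  have h₁ : fderiv ℝ (fun y => g (f y)) y = (fderiv ℝ g (f y)).comp (fderiv ℝ f y) :=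
    ((hg (f y)).hasFDerivAt.comp y (hf y).hasFDerivAt).fderiv
  have h₂ (j : Fin m) : pd i (fun z => (f z j : ℂ)) y =
      ((fderiv ℝ f y (Pi.single i 1) j : ℝ) : ℂ) := by
    rw [pd_ofReal fun z => differentiableAt_pi.1 (hf z) j]
    have := (hasFDerivAt_pi'.1 (hf y).hasFDerivAt j).fderiv
    exact congrArg (fun L => ((L (Pi.single i 1) : ℝ) : ℂ)) this
  simp only [h₂]
  rw [pd, h₁, ContinuousLinearMap.comp_apply]
  conv_lhs => rw [pi_eq_sum_univ' (fderiv ℝ f y (Pi.single i 1)), map_sum]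
  refine Finset.sum_congr rfl fun j _ => ?_
  rw [map_smul, Complex.real_smul, mul_comm, pd]

lemma constantCoeff_aeval {σ τ R : Type*} [CommRing R] {Y : σ → MvPolynomial τ R}
    (hY : ∀ j, constantCoeff (Y j) = 0) (q : MvPolynomial σ R) :
    constantCoeff (aeval Y q) = constantCoeff q := by
  induction q using MvPolynomial.induction_on with
  | C a => simp [algebraMap_eq]
  | add p q hp hq => simp only [map_add, hp, hq]
  | mul_X p j hp => simp only [map_mul, aeval_X, hY, constantCoeff_X, mul_zero]

lemma IsJet.comp {K : ℕ} {f : (Fin n → ℝ) → (Fin m → ℝ)} {g : (Fin m → ℝ) → ℂ}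
    {q : MvPolynomial (Fin m) ℂ} {p : Fin m → MvPolynomial (Fin n) ℂ}
    (hf : ContDiff ℝ K f) (hg : ContDiff ℝ K g) (Hg : IsJet (f x) K g q)
    (Hf : ∀ j, IsJet x K (fun y => (f y j : ℂ)) (p j)) :
    IsJet x K (fun y => g (f y)) (aeval (fun j => p j - C (f x j : ℂ)) q) := by
  have hconst : constantCoeff (aeval (fun j => p j - C (f x j : ℂ)) q) = g (f x) := by
    rw [constantCoeff_aeval fun j => by simp [(Hf j).constantCoeff_eq], Hg.constantCoeff_eq]
  induction K generalizing g q with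
  | zero => exact hconst
  | succ K ih =>
    refine ⟨hconst, fun i => ?_⟩
    have hf' : ContDiff ℝ K f := hf.of_le (by norm_cast; omega)
    have hfj (j : Fin m) : ContDiff ℝ (K + 1 : ℕ) fun y => (f y j : ℂ) :=
      Complex.ofRealCLM.contDiff.comp (contDiff_pi.1 hf j)
    rw [pd_comp (hf.differentiable (by norm_cast)) (hg.differentiable (by norm_cast)),
      pderiv_aeval_eq_sum]
    have c₁ (j : Fin m) : ContDiff ℝ K fun y => pd j g (f y) := (hg.partialDeriv j).comp hf'
    have c₂ (j : Fin m) := (hfj j).partialDeriv i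
    refine IsJet.sum _ (fun j => (c₁ j).mul (c₂ j)) fun j => (IsJet.mul (c₁ j) (c₂ j) ?_ ?_)
    · exact ih hf' (hg.partialDeriv j) (Hg.2 j) (fun l => (Hf l).of_succ)
        (by rw [constantCoeff_aeval fun j => by simp [(Hf j).constantCoeff_eq],
          (Hg.2 j).constantCoeff_eq])
    · rw [map_sub, pderiv_C, sub_zero]
      exact (Hf j).2 i

lemma prod_factorial_add_single (β : Fin n → ℕ) (i : Fin n) :
    ∏ j, ((β + Pi.single i 1 : Fin n → ℕ) j).factorial = (β i + 1) * ∏ j, (β j).factorial := by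
  rw [← Finset.mul_prod_erase _ _ (Finset.mem_univ i),
    ← Finset.mul_prod_erase _ (fun j => (β j).factorial) (Finset.mem_univ i), ← mul_assoc]
  congr 1
  · simp [Nat.factorial_succ]
  · refine Finset.prod_congr rfl fun j hj => ?_
    simp [Pi.single_eq_of_ne (Finset.ne_of_mem_erase hj)]

lemma isJet_iff_coeff {K : ℕ} {h : (Fin n → ℝ) → 𝕜} {p : MvPolynomial (Fin n) 𝕜}
    (c : ContDiff ℝ K h) :
    IsJet x K h p ↔ ∀ β : Fin n →₀ ℕ, ∑ i, β i ≤ K →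
      coeff β p = mderiv β h x / ((∏ i, (β i).factorial : ℕ) : 𝕜) := by
  have hzero (h : (Fin n → ℝ) → 𝕜) (p : MvPolynomial (Fin n) 𝕜) : constantCoeff p = h x ↔
      coeff 0 p = mderiv (0 : Fin n →₀ ℕ) h x /
        ((∏ i, ((0 : Fin n →₀ ℕ) i).factorial : ℕ) : 𝕜) := by
    simp [mderiv_zero, constantCoeff_eq]
  induction K generalizing h p with
  | zero =>
    rw [IsJet, hzero]
    refine ⟨fun H β hβ => ?_, fun H => H 0 (by simp)⟩
    have : β = 0 := by ext i; simpa using Finset.sum_eq_zero_iff.1 (Nat.le_zero.1 hβ) i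
    rwa [this]
  | succ K ih =>
    have step (i : Fin n) (β : Fin n →₀ ℕ) (hβ : ∑ j, β j ≤ K) :
        coeff β (pderiv i p) = mderiv β (pd i h) x / ((∏ i, (β i).factorial : ℕ) : 𝕜) ↔
        coeff (β + Finsupp.single i 1) p = mderiv (β + Finsupp.single i 1 : Fin n →₀ ℕ) h x /
          ((∏ j, ((β + Finsupp.single i 1 : Fin n →₀ ℕ) j).factorial : ℕ) : 𝕜) := by
      have e : ⇑(β + Finsupp.single i 1 : Fin n →₀ ℕ) = ⇑β + Pi.single i 1 := by
        rw [Finsupp.coe_add, Finsupp.single_eq_pi_single]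
      have hc : ContDiff ℝ (∑ j, β j + 1 : ℕ) h := c.of_le (by exact_mod_cast Nat.succ_le_succ hβ)
      rw [coeff_pderiv, e, mderiv_add_single i β hc,
        prod_factorial_add_single]
      have h₁ : (β i : 𝕜) + 1 ≠ 0 := Nat.cast_add_one_ne_zero _
      have h₂ : ((∏ j, (β j).factorial : ℕ) : 𝕜) ≠ 0 :=
        Nat.cast_ne_zero.2 (Finset.prod_ne_zero_iff.2 fun j _ => Nat.factorial_ne_zero _)
      rw [eq_div_iff h₂, eq_div_iff (by push_cast at h₂ ⊢; exact mul_ne_zero h₁ h₂)]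
      push_cast
      rw [mul_assoc]
    rw [IsJet, hzero]
    have ih' (i : Fin n) := ih (h := pd i h) (p := pderiv i p) (c.partialDeriv i)
    constructor
    · rintro ⟨H₀, H⟩ β hβ
      by_cases hb : β = 0
      · rwa [hb]
      obtain ⟨i, hi⟩ := Finsupp.ne_iff.1 hb
      have hle : Finsupp.single i 1 ≤ β := by
        simpa [Nat.one_le_iff_ne_zero] using hi
      obtain ⟨β', rfl⟩ := exists_add_of_le hle
      rw [add_comm (Finsupp.single i 1)] at hβ ⊢
      have hβ' : ∑ j, β' j ≤ K := by
        simp only [Finsupp.add_apply, Finset.sum_add_distrib, Finsupp.single_apply] at hβ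
        simpa using hβ
      exact (step i β' hβ').1 ((ih' i).1 (H i) β' hβ')
    · refine fun H => ⟨H 0 (by simp), fun i => (ih' i).2 fun β hβ => (step i β hβ).2 (H _ ?_)⟩
      simp only [Finsupp.add_apply, Finset.sum_add_distrib, Finsupp.single_apply]
      simpa using hβ

lemma mem_multiIdxBetween {K : ℕ} {β : Fin n → ℕ} :
    β ∈ multiIdxBetween n K ↔ 1 ≤ ∑ i, β i ∧ ∑ i, β i ≤ K := by
  simp only [multiIdxBetween, Finset.mem_filter, Fintype.mem_piFinset, Finset.mem_range,
    and_iff_right_iff_imp, Nat.lt_succ_iff]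
  exact fun h i => (Finset.single_le_sum (fun _ _ => Nat.zero_le _) (Finset.mem_univ i)).trans h.2

lemma isJet_taylor {K : ℕ} {h : (Fin n → ℝ) → 𝕜} (c : ContDiff ℝ K h) :
    IsJet x K h (C (h x) + ∑ b ∈ multiIdxBetween n K,
      monomial (Finsupp.equivFunOnFinite.symm b)
        (mderiv b h x / ((∏ i, (b i).factorial : ℕ) : 𝕜))) := by
  classical
  refine (isJet_iff_coeff c).2 fun β hβ => ?_
  simp only [coeff_add, coeff_C, coeff_sum, coeff_monomial, Equiv.symm_apply_eq]
  have hcoe : Finsupp.equivFunOnFinite β = ⇑β := rfl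
  rw [Finset.sum_ite_eq', hcoe]
  by_cases hb : β = 0
  · subst hb
    rw [if_neg fun H : ⇑(0 : Fin n →₀ ℕ) ∈ multiIdxBetween n K => by
      simpa using (mem_multiIdxBetween.1 H).1]
    simp [mderiv_zero]
  · have hmem : ⇑β ∈ multiIdxBetween n K := by
      refine mem_multiIdxBetween.2 ⟨Nat.one_le_iff_ne_zero.2 fun H => hb ?_, hβ⟩
      ext i
      simpa using Finset.sum_eq_zero_iff.1 H i
    rw [if_pos hmem, if_neg (Ne.symm hb), zero_add]

lemma prod_monomial {σ ι R : Type*} [CommSemiring R] (s : Finset ι) (v : ι → σ →₀ ℕ) (c : ι → R) :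
    ∏ i ∈ s, monomial (v i) (c i) = monomial (∑ i ∈ s, v i) (∏ i ∈ s, c i) := by
  classical
  induction s using Finset.induction_on with
  | empty => simp
  | insert a s ha ih =>
    rw [Finset.prod_insert ha, Finset.sum_insert ha, Finset.prod_insert ha, ih, monomial_mul]

lemma C_mul_sum_monomial_pow {σ ι F : Type*} [Fintype ι] [DecidableEq ι] [Field F] [CharZero F]
    (v : ι → σ →₀ ℕ) (c : ι → F) (a : ℕ) :
    C (1 / (a.factorial : F)) * (∑ b, monomial (v b) (c b)) ^ a =
      ∑ k ∈ Finset.piAntidiag Finset.univ a,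
        monomial (∑ b, k b • v b) (∏ b, (1 / ((k b).factorial : F) * c b ^ k b)) := by
  rw [Finset.sum_pow_eq_sum_piAntidiag, Finset.mul_sum]
  refine Finset.sum_congr rfl fun k hk => ?_
  simp only [monomial_pow]
  rw [prod_monomial, ← C_eq_coe_nat, C_mul_monomial, C_mul_monomial, ← mul_assoc,
    Finset.prod_mul_distrib]
  congr 2
  have hspec := congrArg (Nat.cast (R := F)) (Nat.multinomial_spec Finset.univ k)
  rw [(Finset.mem_piAntidiag.1 hk).1] at hspec
  have h₁ : (a.factorial : F) ≠ 0 := Nat.cast_ne_zero.2 a.factorial_ne_zero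
  have h₂ : ∏ b, ((k b).factorial : F) ≠ 0 :=
    Finset.prod_ne_zero_iff.2 fun b _ => Nat.cast_ne_zero.2 (k b).factorial_ne_zero
  simp only [one_div, Finset.prod_inv_distrib]
  push_cast at hspec
  field_simp
  rw [mul_comm, hspec]

lemma coeff_prod_sum_monomial_pow {F : Type*} [Field F] [CharZero F] {K : ℕ} {α : Fin m → ℕ}
    (hα : ∑ j, α j ≤ K) (γ : Fin n →₀ ℕ) (c : famIdx n m K → F) :
    coeff γ (∏ j, (C (1 / ((α j).factorial : F)) *
      (∑ b : {β : Fin n → ℕ // β ∈ multiIdxBetween n K},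
        monomial (Finsupp.equivFunOnFinite.symm (b : Fin n → ℕ)) (c (j, b))) ^ α j)) =
      ∑ N ∈ famSet n m K α γ, ∏ p, (1 / ((N p).factorial : F) * c p ^ N p) := by
  classical
  simp only [C_mul_sum_monomial_pow]
  rw [Finset.prod_univ_sum]
  simp only [prod_monomial, coeff_sum, coeff_monomial]
  rw [← Finset.sum_filter]
  refine Finset.sum_nbij' (fun N p => N p.1 p.2) (fun N j b => N (j, b)) ?_ ?_ ?_ ?_ ?_
  · intro N hN
    simp only [Finset.mem_filter, Fintype.mem_piFinset, Finset.mem_piAntidiag] at hN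
    simp only [famSet, Finset.mem_filter, Fintype.mem_piFinset, Finset.mem_range, Nat.lt_succ_iff]
    refine ⟨fun p => ?_, fun j => (hN.1 j).1, fun i => ?_⟩
    · calc N p.1 p.2 ≤ ∑ b, N p.1 b :=
            Finset.single_le_sum (fun _ _ => Nat.zero_le _) (Finset.mem_univ _)
        _ = α p.1 := (hN.1 p.1).1
        _ ≤ ∑ j, α j := Finset.single_le_sum (fun _ _ => Nat.zero_le _) (Finset.mem_univ _)
        _ ≤ K := hα
    · rw [← hN.2]
      simp
  · intro N hN
    simp only [famSet, Finset.mem_filter] at hN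
    simp only [Finset.mem_filter, Fintype.mem_piFinset, Finset.mem_piAntidiag]
    refine ⟨fun j => ⟨hN.2.1 j, by simp⟩, ?_⟩
    ext i
    rw [← hN.2.2 i]
    simp
  · exact fun _ _ => rfl
  · exact fun _ _ => rfl
  · intro N _
    rw [Fintype.prod_prod_type]

end Jets

/-- the multivariate higher-order chain rule (Faà di Bruno formula):
`∂^γ(g∘f)(x₀) = Σ_{1≤|α|≤|γ|} ∂^α g(f(x₀)) Σ_N γ! Π_{j,β} (1/N(j,β)!)(∂^β f_j(x₀)/β!)^{N(j,β)}`. -/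
theorem statement19 {n m : ℕ} (hn : 1 ≤ n) (hm : 1 ≤ m) (k : ℕ) (hk : 1 ≤ k)
    (f : (Fin n → ℝ) → (Fin m → ℝ)) (g : (Fin m → ℝ) → ℂ)
    (hf : ContDiff ℝ (k : ℕ∞) f) (hg : ContDiff ℝ (k : ℕ∞) g)
    (x₀ : Fin n → ℝ) (γ : Fin n → ℕ) (hγ₁ : 1 ≤ ∑ i, γ i) (hγ₂ : ∑ i, γ i ≤ k) :
    mderiv γ (fun x => g (f x)) x₀ =
      ∑ α ∈ multiIdxBetween m (∑ i, γ i),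
        mderiv α g (f x₀) *
          ∑ N ∈ famSet n m (∑ i, γ i) α γ,
            ((∏ i, (γ i).factorial : ℕ) : ℂ) *
              ∏ p : famIdx n m (∑ i, γ i),
                (1 / ((N p).factorial : ℂ)) *
                  (((mderiv (p.2 : Fin n → ℕ) (fun x => f x p.1) x₀ /
                      ((∏ i, ((p.2 : Fin n → ℕ) i).factorial : ℕ) : ℝ)) : ℝ) : ℂ) ^ N p := by
  set K := ∑ i, γ i with hK
  have hf' : ContDiff ℝ K f := hf.of_le (by exact_mod_cast hγ₂)
  have hg' : ContDiff ℝ K g := hg.of_le (by exact_mod_cast hγ₂)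
  have hfj (j : Fin m) : ContDiff ℝ K fun x => f x j := contDiff_pi.1 hf' j
  have Hf (j : Fin m) := (isJet_taylor (x := x₀) (hfj j)).ofReal (hfj j)
  have H₀ := IsJet.comp hf' hg' (isJet_taylor hg') Hf
  have H := (isJet_iff_coeff (hg'.comp hf')).1 H₀
    (Finsupp.equivFunOnFinite.symm γ) le_rfl
  have hγfac : ((∏ i, (γ i).factorial : ℕ) : ℂ) ≠ 0 :=
    Nat.cast_ne_zero.2 (Finset.prod_ne_zero_iff.2 fun i _ => Nat.factorial_ne_zero _)
  have hγ₀ : (0 : Fin n →₀ ℕ) ≠ Finsupp.equivFunOnFinite.symm γ := by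
    intro h
    have : γ = 0 := by
      rw [← Finsupp.equivFunOnFinite.apply_symm_apply γ, ← h]
      rfl
    simp [hK, this] at hγ₁
  rw [Finsupp.coe_equivFunOnFinite_symm, eq_div_iff hγfac] at H
  refine H.symm.trans ?_
  simp only [map_add, map_sum, MvPolynomial.map_C, MvPolynomial.map_monomial,
    Complex.ofRealHom_eq_coe, add_sub_cancel_left, MvPolynomial.aeval_C,
    MvPolynomial.algebraMap_eq, MvPolynomial.coeff_add, MvPolynomial.coeff_sum,
    MvPolynomial.coeff_C, if_neg hγ₀, zero_add, MvPolynomial.aeval_monomial]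
  rw [Finset.sum_mul]
  refine Finset.sum_congr rfl fun α hα => ?_
  have hcoeff := coeff_prod_sum_monomial_pow (mem_multiIdxBetween.1 hα).2
    (Finsupp.equivFunOnFinite.symm γ) fun p : famIdx n m K =>
      ((mderiv (p.2 : Fin n → ℕ) (fun x => f x p.1) x₀ /
        ((∏ i, ((p.2 : Fin n → ℕ) i).factorial : ℕ) : ℝ) : ℝ) : ℂ)
  rw [Finsupp.coe_equivFunOnFinite_symm] at hcoeff
  rw [← Finset.mul_sum, ← hcoeff, Finset.prod_mul_distrib, ← map_prod, MvPolynomial.coeff_C_mul,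
    Finsupp.prod_fintype _ _ fun _ => pow_zero _, MvPolynomial.coeff_C_mul]
  rw [Finsupp.coe_equivFunOnFinite_symm]
  simp only [← Finset.sum_coe_sort (multiIdxBetween n K), one_div, Finset.prod_inv_distrib,
    Nat.cast_prod]
  ring
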